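/- Let r₁ = p₁/q₁ and r₂ = p₂/q₂ be distinct rational numbers in lowest terms with p₁ and p₂ nonzero, and let (θ,η) ∈ Ŝ(r₁) ∩ Ŝ(r₂) ∩ W*. For i = 1, 2: if η > π|p_i|/Δ(r₁,r₂), then there exists a point (θ',η') ∈ Ŝ(r₁) ∩ Ŝ(r₂) ∩ W* adjacent to (θ,η) in Ŝ(r_i) with η' < η; and if η < 2π − π|p_i|/Δ(r₁,r₂), then there exists a point (θ',η') ∈ Ŝ(r₁) ∩ Ŝ(r₂) ∩ W* adjacent to (θ,η) in Ŝ(r_i) with η' > η. -/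

import Mathlib

open Real

/-- The set `S(p/q) = {(θ,η) : pθ+qη ∈ 2πℤ or pθ+pπ+qη ∈ 2πℤ}`. -/
def Spq (p q : ℤ) : Set (ℝ × ℝ) :=
  {x | (∃ k : ℤ, (p : ℝ) * x.1 + (q : ℝ) * x.2 = 2 * π * k) ∨
       (∃ k : ℤ, (p : ℝ) * x.1 + (p : ℝ) * π + (q : ℝ) * x.2 = 2 * π * k)}

/-- The set `Ŝ(p/q) = {(θ,η) : pθ+qη ∈ πℤ}`. -/
def Shat (p q : ℤ) : Set (ℝ × ℝ) :=
  {x | ∃ k : ℤ, (p : ℝ) * x.1 + (q : ℝ) * x.2 = π * k}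

/-- The open strip `W* = ℝ × (0, 2π)`. -/
def Wstar : Set (ℝ × ℝ) :=
  {x | 0 < x.2 ∧ x.2 < 2 * π}

/-- Two points `a ≠ b` are adjacent in `L` relative to the set `X` of intersection points:
they lie on the same connected component of `L` and no point of `X` lies strictly
between them. -/
def AdjacentIn (L X : Set (ℝ × ℝ)) (a b : ℝ × ℝ) : Prop :=
  a ≠ b ∧ b ∈ connectedComponentIn L a ∧ ∀ c ∈ X, c ∉ openSegment ℝ a b

/-- The quantity `d₁(r₁,r₂)` of the paper, where `r₁ = p₁/q₁` and `r₂ = p₂/q₂`: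
`2π|p₁|/Δ(r₁,r₂)` if `p₂` is even, and `π|p₁|/Δ(r₁,r₂)` if `p₂` is odd
(`d₂(r₁,r₂)` is obtained by swapping the roles of the two fractions). -/
noncomputable def dd (p₁ q₁ p₂ q₂ : ℤ) : ℝ :=
  if Even p₂ then 2 * π * |(p₁ : ℝ)| / |((p₁ * q₂ - p₂ * q₁ : ℤ) : ℝ)|
  else π * |(p₁ : ℝ)| / |((p₁ * q₂ - p₂ * q₁ : ℤ) : ℝ)|

/-- Moving from a point of `Ŝ(p/q) ∩ Ŝ(p'/q') ∩ W*` along its line in `Ŝ(p/q)` by `π e / Δ` times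
the direction vector `(-q, p)`, where `e = ±1`, reaches an adjacent intersection point, as long as
it stays inside `W*`. -/
theorem adjacentIn_translate (p q p' q' e : ℤ) (he : e = 1 ∨ e = -1)
    (hne : p * q' - p' * q ≠ 0) (hp : p ≠ 0)
    (a b : ℝ × ℝ) (ha : a ∈ Shat p q ∩ Shat p' q' ∩ Wstar) (hb : b ∈ Wstar)
    (h₁ : b.1 = a.1 - e * (π / ((p * q' - p' * q : ℤ) : ℝ)) * q)
    (h₂ : b.2 = a.2 + e * (π / ((p * q' - p' * q : ℤ) : ℝ)) * p) :
    b ∈ Shat p q ∩ Shat p' q' ∩ Wstar ∧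
      AdjacentIn (Shat p q ∩ Wstar) (Shat p q ∩ Shat p' q' ∩ Wstar) a b := by
  obtain ⟨⟨⟨k, hk⟩, ⟨l, hl⟩⟩, haW⟩ := ha
  have hD : ((p * q' - p' * q : ℤ) : ℝ) ≠ 0 := by exact_mod_cast hne
  have hpR : (p : ℝ) ≠ 0 := by exact_mod_cast hp
  have heR : (e : ℝ) ≠ 0 := by rcases he with rfl | rfl <;> norm_num
  have hpi := Real.pi_pos
  set t : ℝ := π / ((p * q' - p' * q : ℤ) : ℝ) with ht
  have ht0 : t ≠ 0 := div_ne_zero hpi.ne' hD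
  have htD : t * ((p : ℝ) * q' - p' * q) = π := by
    have : t * ((p * q' - p' * q : ℤ) : ℝ) = π := div_mul_cancel₀ _ hD
    simpa using this
  have hbk : (p : ℝ) * b.1 + q * b.2 = π * k := by rw [h₁, h₂]; linear_combination hk
  have hbl : (p' : ℝ) * b.1 + q' * b.2 = π * (l + e) := by
    rw [h₁, h₂]; linear_combination hl + e * htD
  refine ⟨⟨⟨⟨k, hbk⟩, ⟨l + e, by push_cast; exact hbl⟩⟩, hb⟩, ?_, ?_, ?_⟩
  · rintro rfl
    have : (e : ℝ) * t * p = 0 := by linarith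
    exact mul_ne_zero (mul_ne_zero heR ht0) hpR this
  · refine (convex_segment a b).isPreconnected.subset_connectedComponentIn
      (left_mem_segment ℝ a b) ?_ (right_mem_segment ℝ a b)
    rintro c ⟨u, v, hu, hv, huv, rfl⟩
    have hW : Convex ℝ Wstar := (convex_Ioo (0 : ℝ) (2 * π)).linear_preimage (LinearMap.snd ℝ ℝ ℝ)
    refine ⟨⟨k, ?_⟩, hW haW hb hu hv huv⟩
    simp only [Prod.fst_add, Prod.snd_add, Prod.smul_fst, Prod.smul_snd, smul_eq_mul]
    linear_combination u * hk + v * hbk + π * k * huv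
  · rintro c ⟨⟨-, ⟨m, hm⟩⟩, -⟩ ⟨u, v, hu, hv, huv, rfl⟩
    simp only [Prod.fst_add, Prod.snd_add, Prod.smul_fst, Prod.smul_snd, smul_eq_mul] at hm
    have hmul : π * (v * e) = π * ((m - l : ℤ) : ℝ) := by
      push_cast
      linear_combination hm - u * hl - v * hbl - π * l * huv
    have hve : v * e = ((m - l : ℤ) : ℝ) := mul_left_cancel₀ hpi.ne' hmul
    generalize m - l = n at hve
    rcases he with rfl | rfl
    · have h0 : (0 : ℝ) < n := by push_cast at hve; linarith
      have h1 : (n : ℝ) < 1 := by push_cast at hve; linarith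
      norm_cast at h0 h1
      omega
    · have h0 : (-1 : ℝ) < n := by push_cast at hve; linarith
      have h1 : (n : ℝ) < 0 := by push_cast at hve; linarith
      norm_cast at h0 h1
      omega

/-- There is a sign `e` for which `e π p / D` equals `π |p| / |D|`. -/
theorem exists_sign_mul_pi_div (p D : ℤ) :
    ∃ e : ℤ, (e = 1 ∨ e = -1) ∧ (e : ℝ) * (π / (D : ℝ)) * p = π * |(p : ℝ)| / |(D : ℝ)| := by
  rcases abs_choice (p : ℝ) with h | h <;> rcases abs_choice (D : ℝ) with h' | h' <;> rw [h, h']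
  · exact ⟨1, Or.inl rfl, by push_cast; ring⟩
  · exact ⟨-1, Or.inr rfl, by push_cast; rw [div_neg]; ring⟩
  · exact ⟨-1, Or.inr rfl, by push_cast; ring⟩
  · exact ⟨1, Or.inl rfl, by push_cast; rw [div_neg]; ring⟩

/-- Adjacent intersection points along `Ŝ(p/q)`, below and above a given one. -/
theorem exists_adjacentIn (p q p' q' : ℤ) (hp : p ≠ 0) (hne : p * q' - p' * q ≠ 0)
    (a : ℝ × ℝ) (ha : a ∈ Shat p q ∩ Shat p' q' ∩ Wstar) :
    (π * |(p : ℝ)| / |((p * q' - p' * q : ℤ) : ℝ)| < a.2 →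
        ∃ b ∈ Shat p q ∩ Shat p' q' ∩ Wstar,
        AdjacentIn (Shat p q ∩ Wstar) (Shat p q ∩ Shat p' q' ∩ Wstar) a b ∧ b.2 < a.2) ∧
     (a.2 < 2 * π - π * |(p : ℝ)| / |((p * q' - p' * q : ℤ) : ℝ)| →
        ∃ b ∈ Shat p q ∩ Shat p' q' ∩ Wstar,
        AdjacentIn (Shat p q ∩ Wstar) (Shat p q ∩ Shat p' q' ∩ Wstar) a b ∧ a.2 < b.2) := by
  obtain ⟨e, he, hstep⟩ := exists_sign_mul_pi_div p (p * q' - p' * q)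
  have hpos : 0 < π * |(p : ℝ)| / |((p * q' - p' * q : ℤ) : ℝ)| :=
    div_pos (mul_pos Real.pi_pos (abs_pos.2 (by exact_mod_cast hp)))
      (abs_pos.2 (by exact_mod_cast hne))
  obtain ⟨ha0, ha1⟩ := ha.2
  rw [← hstep] at hpos ⊢
  constructor <;> intro h
  · obtain ⟨hb, hadj⟩ := adjacentIn_translate p q p' q' (-e) (by omega) hne hp a
      (a.1 - (-e : ℤ) * (π / ((p * q' - p' * q : ℤ) : ℝ)) * q,
        a.2 + (-e : ℤ) * (π / ((p * q' - p' * q : ℤ) : ℝ)) * p) ha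
      (by constructor <;> rw [Int.cast_neg] <;> dsimp only <;> linarith) rfl rfl
    exact ⟨_, hb, hadj, by rw [Int.cast_neg]; dsimp only; linarith⟩
  · obtain ⟨hb, hadj⟩ := adjacentIn_translate p q p' q' e he hne hp a
      (a.1 - e * (π / ((p * q' - p' * q : ℤ) : ℝ)) * q,
        a.2 + e * (π / ((p * q' - p' * q : ℤ) : ℝ)) * p) ha
      (by constructor <;> dsimp only <;> linarith) rfl rfl
    exact ⟨_, hb, hadj, by dsimp only; linarith⟩

/-- Existence of adjacent intersection points below / above a given point of
`Ŝ(r₁) ∩ Ŝ(r₂) ∩ W*`, provided there is room. -/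
theorem statement_9 (p₁ q₁ p₂ q₂ : ℤ) (hq₁ : q₁ ≠ 0) (hq₂ : q₂ ≠ 0)
    (hp₁ : p₁ ≠ 0) (hp₂ : p₂ ≠ 0)
    (hc₁ : IsCoprime p₁ q₁) (hc₂ : IsCoprime p₂ q₂)
    (hne : p₁ * q₂ ≠ p₂ * q₁)
    (a : ℝ × ℝ) (ha : a ∈ Shat p₁ q₁ ∩ Shat p₂ q₂ ∩ Wstar) :
    ((π * |(p₁ : ℝ)| / |((p₁ * q₂ - p₂ * q₁ : ℤ) : ℝ)| < a.2 →
        ∃ b ∈ Shat p₁ q₁ ∩ Shat p₂ q₂ ∩ Wstar,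
        AdjacentIn (Shat p₁ q₁ ∩ Wstar) (Shat p₁ q₁ ∩ Shat p₂ q₂ ∩ Wstar) a b ∧ b.2 < a.2) ∧
     (a.2 < 2 * π - π * |(p₁ : ℝ)| / |((p₁ * q₂ - p₂ * q₁ : ℤ) : ℝ)| →
        ∃ b ∈ Shat p₁ q₁ ∩ Shat p₂ q₂ ∩ Wstar,
        AdjacentIn (Shat p₁ q₁ ∩ Wstar) (Shat p₁ q₁ ∩ Shat p₂ q₂ ∩ Wstar) a b ∧ a.2 < b.2)) ∧
    ((π * |(p₂ : ℝ)| / |((p₁ * q₂ - p₂ * q₁ : ℤ) : ℝ)| < a.2 →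
        ∃ b ∈ Shat p₁ q₁ ∩ Shat p₂ q₂ ∩ Wstar,
        AdjacentIn (Shat p₂ q₂ ∩ Wstar) (Shat p₁ q₁ ∩ Shat p₂ q₂ ∩ Wstar) a b ∧ b.2 < a.2) ∧
     (a.2 < 2 * π - π * |(p₂ : ℝ)| / |((p₁ * q₂ - p₂ * q₁ : ℤ) : ℝ)| →
        ∃ b ∈ Shat p₁ q₁ ∩ Shat p₂ q₂ ∩ Wstar,
        AdjacentIn (Shat p₂ q₂ ∩ Wstar) (Shat p₁ q₁ ∩ Shat p₂ q₂ ∩ Wstar) a b ∧ a.2 < b.2)) := by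
  refine ⟨exists_adjacentIn p₁ q₁ p₂ q₂ hp₁ (sub_ne_zero.2 hne) a ha, ?_⟩
  have habs : |((p₁ * q₂ - p₂ * q₁ : ℤ) : ℝ)| = |((p₂ * q₁ - p₁ * q₂ : ℤ) : ℝ)| := by
    rw [← Int.cast_abs, ← Int.cast_abs, abs_sub_comm]
  rw [habs, Set.inter_comm (Shat p₁ q₁) (Shat p₂ q₂)]
  rw [Set.inter_comm (Shat p₁ q₁) (Shat p₂ q₂)] at ha
  exact exists_adjacentIn p₂ q₂ p₁ q₁ hp₂ (sub_ne_zero.2 hne.symm) a ha
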